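/- Let β > 0, γ ∈ ℝ, d ≥ 1, and fix φ, ξ ∈ ℝ^d with (φ,ξ) ≠ (0,0). There exists a constant C < ∞ depending only on β and γ (in particular not on φ, ξ) such that for every measurable h : ℝ → ℂ with ∫_ℝ W(s,φ,ξ)^{γ−β}·|h(s)| ds < ∞, the following hold: for every t ∈ ℝ the integral (Th)(t) = ∫_{−∞}^t K(t,s,φ,ξ)·h(s) ds converges absolutely; the function t ↦ W(t,φ,ξ)^{γ−β}·(Th)(t) is continuous on ℝ and tends to 0 as t → ±∞; and sup_{t∈ℝ} W(t,φ,ξ)^{γ−β}·|(Th)(t)| ≤ C·∫_ℝ W(s,φ,ξ)^{γ−β}·|h(s)| ds. -/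

import Mathlib

open MeasureTheory Real Filter

/-- The weight `W(t,φ,ξ) = max(‖ξ - tφ‖, ‖φ‖^{1/(1+2β)})`. -/
noncomputable def Wgt (β : ℝ) {d : ℕ} (t : ℝ) (φ ξ : EuclideanSpace ℝ (Fin d)) : ℝ :=
  max ‖ξ - t • φ‖ (‖φ‖ ^ (1 / (1 + 2 * β)))

/-- The Kolmogorov kernel `K(t,s,φ,ξ) = exp(-∫_s^t ‖ξ - τφ‖^{2β} dτ)`. -/
noncomputable def Kker (β : ℝ) {d : ℕ} (t s : ℝ) (φ ξ : EuclideanSpace ℝ (Fin d)) : ℝ :=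
  Real.exp (-(∫ τ in s..t, ‖ξ - τ • φ‖ ^ (2 * β)))

/-- The Duhamel integral `(Th)(t) = ∫_{-∞}^t K(t,s) h(s) ds`. -/
noncomputable def Duh (β : ℝ) {d : ℕ} (φ ξ : EuclideanSpace ℝ (Fin d))
    (h : ℝ → ℂ) (t : ℝ) : ℂ :=
  ∫ s in Set.Iic t, (↑(Kker β t s φ ξ) : ℂ) * h s

section KolmogorovKernel

variable {β : ℝ} {d : ℕ}

lemma continuous_norm_sub_smul_rpow (hβ : 0 < β) (φ ξ : EuclideanSpace ℝ (Fin d)) :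
    Continuous (fun τ : ℝ => ‖ξ - τ • φ‖ ^ (2 * β)) := by
  refine Continuous.rpow_const (by fun_prop) fun _ => Or.inr (by positivity)

/-- The logarithm of the truncated distance `max ‖ξ - τφ‖ m` grows at most as fast as the
integral of `‖ξ - τφ‖^{2β}` once `m` is large compared with `‖φ‖`. -/
lemma mul_log_max_sub_le_integral (hβ : 0 < β) (φ ξ : EuclideanSpace ℝ (Fin d)) {k m : ℝ}
    (hk : 0 ≤ k) (hm : 0 ≤ m) (hkm : k * ‖φ‖ ≤ m ^ (1 + 2 * β))
    (hpos : ∀ τ : ℝ, 0 < max ‖ξ - τ • φ‖ m) {s t : ℝ} (hst : s ≤ t) :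
    k * log (max ‖ξ - t • φ‖ m) - k * log (max ‖ξ - s • φ‖ m)
      ≤ ∫ τ in s..t, ‖ξ - τ • φ‖ ^ (2 * β) := by
  have hcont := continuous_norm_sub_smul_rpow hβ φ ξ
  have hM : Continuous fun τ : ℝ => max ‖ξ - τ • φ‖ m := by fun_prop
  have hf : Continuous fun τ : ℝ =>
      k * log (max ‖ξ - τ • φ‖ m) - k * log (max ‖ξ - s • φ‖ m) :=
    (continuous_const.mul (hM.log fun τ => (hpos τ).ne')).sub continuous_const
  have hderiv : ∀ x : ℝ, HasDerivAt (fun x => ∫ τ in s..x, ‖ξ - τ • φ‖ ^ (2 * β))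
      (‖ξ - x • φ‖ ^ (2 * β)) x := fun x => hcont.integral_hasStrictDerivAt s x |>.hasDerivAt
  refine image_le_of_liminf_slope_right_le_deriv_boundary (a := s) (b := t)
    (f := fun τ : ℝ => k * log (max ‖ξ - τ • φ‖ m) - k * log (max ‖ξ - s • φ‖ m))
    (B := fun x => ∫ τ in s..x, ‖ξ - τ • φ‖ ^ (2 * β))
    (B' := fun x => ‖ξ - x • φ‖ ^ (2 * β)) hf.continuousOn (by simp)
    (fun x _ => (hderiv x).continuousAt.continuousWithinAt)
    (fun x _ => (hderiv x).hasDerivWithinAt) ?_ ⟨hst, le_rfl⟩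
  intro x _ r hr
  refine Eventually.frequently ?_
  rcases lt_or_ge ‖ξ - x • φ‖ m with hlt | hge
  · have hev : ∀ᶠ z in nhds x, ‖ξ - z • φ‖ < m :=
      (Continuous.continuousAt (by fun_prop)).eventually_lt continuousAt_const hlt
    filter_upwards [hev.filter_mono nhdsWithin_le_nhds] with z hz
    have h0 : 0 ≤ ‖ξ - x • φ‖ ^ (2 * β) := by positivity
    simp only [slope_def_field, max_eq_right hz.le, max_eq_right hlt.le, sub_self, zero_div]
    exact h0.trans_lt hr
  · filter_upwards [self_mem_nhdsWithin] with z hz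
    have hzx : 0 < z - x := sub_pos.2 hz
    refine lt_of_le_of_lt ?_ hr
    have hux : 0 < ‖ξ - x • φ‖ := by simpa [max_eq_left hge] using hpos x
    have hlip : max ‖ξ - z • φ‖ m ≤ ‖ξ - x • φ‖ + (z - x) * ‖φ‖ := by
      refine max_le ?_ (hge.trans (le_add_of_nonneg_right (by positivity)))
      have : ξ - z • φ = (ξ - x • φ) - (z - x) • φ := by module
      rw [this]
      refine (norm_sub_le _ _).trans ?_
      rw [norm_smul, Real.norm_eq_abs, abs_of_pos hzx]
    have hlog : log (max ‖ξ - z • φ‖ m) - log ‖ξ - x • φ‖ ≤ (z - x) * ‖φ‖ / ‖ξ - x • φ‖ := by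
      rw [← log_div (hpos z).ne' hux.ne']
      refine (log_le_sub_one_of_pos (div_pos (hpos z) hux)).trans ?_
      rw [sub_le_iff_le_add, div_add_one hux.ne']
      gcongr
      linarith
    have hrate : k * ‖φ‖ / ‖ξ - x • φ‖ ≤ ‖ξ - x • φ‖ ^ (2 * β) := by
      rw [div_le_iff₀ hux, ← rpow_add_one hux.ne', add_comm]
      exact hkm.trans (rpow_le_rpow hm hge (by positivity))
    rw [slope_def_field, max_eq_left hge, div_le_iff₀ hzx]
    calc _ = k * (log (max ‖ξ - z • φ‖ m) - log ‖ξ - x • φ‖) := by ring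
      _ ≤ k * ((z - x) * ‖φ‖ / ‖ξ - x • φ‖) := by gcongr
      _ = k * ‖φ‖ / ‖ξ - x • φ‖ * (z - x) := by ring
      _ ≤ _ := by gcongr

lemma abs_mul_log_max_sub_le_integral (hβ : 0 < β) (φ ξ : EuclideanSpace ℝ (Fin d)) {k m : ℝ}
    (hk : 0 ≤ k) (hm : 0 ≤ m) (hkm : k * ‖φ‖ ≤ m ^ (1 + 2 * β))
    (hpos : ∀ τ : ℝ, 0 < max ‖ξ - τ • φ‖ m) {s t : ℝ} (hst : s ≤ t) :
    |k * log (max ‖ξ - t • φ‖ m) - k * log (max ‖ξ - s • φ‖ m)|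
      ≤ ∫ τ in s..t, ‖ξ - τ • φ‖ ^ (2 * β) := by
  refine abs_le'.2 ⟨mul_log_max_sub_le_integral hβ φ ξ hk hm hkm hpos hst, ?_⟩
  have hrefl : ∀ τ : ℝ, ξ - (s + t) • φ - τ • (-φ) = ξ - (s + t - τ) • φ := fun τ => by module
  have key := mul_log_max_sub_le_integral hβ (-φ) (ξ - (s + t) • φ) hk hm (by simpa using hkm)
    (fun τ => by rw [hrefl]; exact hpos _) hst
  simp only [hrefl, add_sub_cancel_left, add_sub_cancel_right] at key
  rw [intervalIntegral.integral_comp_sub_left (fun τ : ℝ => ‖ξ - τ • φ‖ ^ (2 * β)) (s + t)] at key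
  simp only [add_sub_cancel_left, add_sub_cancel_right] at key
  linarith

lemma Wgt_pos (β : ℝ) {φ ξ : EuclideanSpace ℝ (Fin d)} (h : (φ, ξ) ≠ (0, 0)) (t : ℝ) :
    0 < Wgt β t φ ξ := by
  unfold Wgt
  by_cases hφ : φ = 0
  · have hξ : ξ ≠ 0 := fun hξ => h (by rw [hφ, hξ])
    exact lt_max_of_lt_left (by simpa [hφ] using hξ)
  · exact lt_max_of_lt_right (rpow_pos_of_pos (norm_pos_iff.2 hφ) _)

lemma continuous_Wgt (φ ξ : EuclideanSpace ℝ (Fin d)) : Continuous fun t => Wgt β t φ ξ := by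
  unfold Wgt
  fun_prop

lemma continuous_Kker_left (hβ : 0 < β) (s : ℝ) (φ ξ : EuclideanSpace ℝ (Fin d)) :
    Continuous fun t => Kker β t s φ ξ :=
  Real.continuous_exp.comp (intervalIntegral.continuous_primitive
    (fun _ _ => (continuous_norm_sub_smul_rpow hβ φ ξ).intervalIntegrable _ _) s).neg

lemma continuous_Kker_right (hβ : 0 < β) (t : ℝ) (φ ξ : EuclideanSpace ℝ (Fin d)) :
    Continuous fun s => Kker β t s φ ξ := by
  unfold Kker
  simp only [intervalIntegral.integral_symm t, neg_neg]
  exact Real.continuous_exp.comp (intervalIntegral.continuous_primitive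
    (fun _ _ => (continuous_norm_sub_smul_rpow hβ φ ξ).intervalIntegrable _ _) t)

/-- Propagating the weight through the Kolmogorov kernel costs only a constant. -/
lemma Wgt_rpow_mul_Kker_le (hβ : 0 < β) (a : ℝ) {φ ξ : EuclideanSpace ℝ (Fin d)}
    (h : (φ, ξ) ≠ (0, 0)) {s t : ℝ} (hst : s ≤ t) :
    Wgt β t φ ξ ^ a * Kker β t s φ ξ ≤ (1 + |a|) ^ |a| * Wgt β s φ ξ ^ a := by
  have hA : 1 ≤ 1 + |a| := le_add_of_nonneg_right (abs_nonneg a)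
  have hA0 : 0 < 1 + |a| := by positivity
  set r : ℝ := ‖φ‖ ^ (1 / (1 + 2 * β)) with hr
  have hr0 : 0 ≤ r := by positivity
  have hle : ∀ τ : ℝ, Wgt β τ φ ξ ≤ max ‖ξ - τ • φ‖ ((1 + |a|) * r) := fun τ =>
    max_le_max le_rfl (le_mul_of_one_le_left hr0 hA)
  have hpos : ∀ τ : ℝ, 0 < max ‖ξ - τ • φ‖ ((1 + |a|) * r) := fun τ =>
    (Wgt_pos β h τ).trans_le (hle τ)
  have hge : ∀ τ : ℝ, max ‖ξ - τ • φ‖ ((1 + |a|) * r) ≤ (1 + |a|) * Wgt β τ φ ξ := fun τ => by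
    unfold Wgt
    rw [mul_max_of_nonneg _ _ hA0.le]
    exact max_le_max (le_mul_of_one_le_left (norm_nonneg _) hA) le_rfl
  have hkm : |a| * ‖φ‖ ≤ ((1 + |a|) * r) ^ (1 + 2 * β) := by
    rw [mul_rpow hA0.le hr0, hr, ← rpow_mul (norm_nonneg _), one_div,
      inv_mul_cancel₀ (by positivity), rpow_one]
    gcongr
    calc |a| ≤ 1 + |a| := by linarith
      _ ≤ _ := self_le_rpow_of_one_le hA (by linarith)
  have key := abs_mul_log_max_sub_le_integral hβ φ ξ (abs_nonneg a) (by positivity) hkm hpos hst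
  have l1 : ∀ τ, log (Wgt β τ φ ξ) ≤ log (max ‖ξ - τ • φ‖ ((1 + |a|) * r)) := fun τ =>
    log_le_log (Wgt_pos β h τ) (hle τ)
  have l2 : ∀ τ, log (max ‖ξ - τ • φ‖ ((1 + |a|) * r)) ≤ log (1 + |a|) + log (Wgt β τ φ ξ) :=
    fun τ => by
      rw [← log_mul hA0.ne' (Wgt_pos β h τ).ne']
      exact log_le_log (hpos τ) (hge τ)
  rw [rpow_def_of_pos (Wgt_pos β h t), rpow_def_of_pos (Wgt_pos β h s), rpow_def_of_pos hA0,
    Kker, ← Real.exp_add, ← Real.exp_add, Real.exp_le_exp]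
  obtain ⟨k1, k2⟩ := abs_le.1 key
  rcases abs_cases a with ⟨ha, ha0⟩ | ⟨ha, ha0⟩
  · have m1 := mul_le_mul_of_nonneg_left (l1 t) (abs_nonneg a)
    have m2 := mul_le_mul_of_nonneg_left (l2 s) (abs_nonneg a)
    rw [ha] at k1 k2 m1 m2 ⊢
    linarith
  · have m1 := mul_le_mul_of_nonneg_left (l1 s) (abs_nonneg a)
    have m2 := mul_le_mul_of_nonneg_left (l2 t) (abs_nonneg a)
    rw [ha] at k1 k2 m1 m2 ⊢
    linarith

lemma tendsto_Wgt_atTop {φ : EuclideanSpace ℝ (Fin d)} (hφ : φ ≠ 0)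
    (ξ : EuclideanSpace ℝ (Fin d)) : Tendsto (fun t => Wgt β t φ ξ) atTop atTop := by
  have h1 : Tendsto (fun t : ℝ => t * ‖φ‖ - ‖ξ‖) atTop atTop :=
    tendsto_atTop_add_const_right _ _ (tendsto_id.atTop_mul_const (norm_pos_iff.2 hφ))
  refine tendsto_atTop_mono (fun t => ?_) h1
  refine le_trans ?_ (le_max_left _ _)
  have h2 : ‖t • φ‖ - ‖ξ‖ ≤ ‖ξ - t • φ‖ := by
    rw [norm_sub_rev]
    exact norm_sub_norm_le _ _
  have h3 : t * ‖φ‖ ≤ ‖t • φ‖ := by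
    rw [norm_smul]
    gcongr
    exact le_abs_self t
  linarith

lemma tendsto_Wgt_rpow_mul_Kker (hβ : 0 < β) (a : ℝ) {φ ξ : EuclideanSpace ℝ (Fin d)}
    (h : (φ, ξ) ≠ (0, 0)) (s : ℝ) :
    Tendsto (fun t => Wgt β t φ ξ ^ a * Kker β t s φ ξ) atTop (nhds 0) := by
  by_cases hφ : φ = 0
  · subst hφ
    have hξ : ξ ≠ 0 := fun hξ => h (by rw [hξ])
    have hc : 0 < ‖ξ‖ ^ (2 * β) := rpow_pos_of_pos (norm_pos_iff.2 hξ) _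
    have hlin : Tendsto (fun t : ℝ => (t - s) * ‖ξ‖ ^ (2 * β)) atTop atTop :=
      (tendsto_atTop_add_const_right _ (-s) tendsto_id).atTop_mul_const hc
    have hK := (Real.tendsto_exp_neg_atTop_nhds_zero.comp hlin).const_mul (Wgt β 0 0 ξ ^ a)
    simpa [Wgt, Kker, Function.comp_def] using hK
  · have hlim := (tendsto_Wgt_atTop (β := β) hφ ξ).inv_tendsto_atTop.mul_const
      ((1 + |a + 1|) ^ |a + 1| * Wgt β s φ ξ ^ (a + 1))
    rw [zero_mul] at hlim
    refine squeeze_zero' (Eventually.of_forall fun t => ?_) ?_ hlim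
    · exact mul_nonneg (rpow_nonneg (Wgt_pos β h t).le _) (Real.exp_pos _).le
    · filter_upwards [eventually_ge_atTop s] with t hst
      have hW := Wgt_pos β h t
      have key := Wgt_rpow_mul_Kker_le hβ (a + 1) h hst
      rw [rpow_add_one hW.ne' a] at key
      rw [Pi.inv_apply, le_inv_mul_iff₀ hW]
      linarith

end KolmogorovKernel

/-- Proposition 2.16, fourth item: `W^{γ-β} T : L¹(W^{γ-β}) → C₀(ℝ)` is bounded, with
a constant depending only on `β` and `γ` (not on `φ, ξ`). -/
theorem weighted_duhamel_L1W_to_C0 (β γ : ℝ) (hβ : 0 < β) :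
    ∃ C : ℝ,
      ∀ (d : ℕ), 1 ≤ d → ∀ φ ξ : EuclideanSpace ℝ (Fin d), (φ, ξ) ≠ (0, 0) →
        ∀ h : ℝ → ℂ, Measurable h →
          Integrable (fun s : ℝ => Wgt β s φ ξ ^ (γ - β) * ‖h s‖) →
          (∀ t : ℝ, IntegrableOn (fun s : ℝ => (↑(Kker β t s φ ξ) : ℂ) * h s) (Set.Iic t)) ∧
          Continuous (fun t : ℝ => (↑(Wgt β t φ ξ ^ (γ - β)) : ℂ) * Duh β φ ξ h t) ∧
          Tendsto (fun t : ℝ => (↑(Wgt β t φ ξ ^ (γ - β)) : ℂ) * Duh β φ ξ h t)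
            atTop (nhds 0) ∧
          Tendsto (fun t : ℝ => (↑(Wgt β t φ ξ ^ (γ - β)) : ℂ) * Duh β φ ξ h t)
            atBot (nhds 0) ∧
          ∀ t : ℝ, Wgt β t φ ξ ^ (γ - β) * ‖Duh β φ ξ h t‖
            ≤ C * ∫ s : ℝ, Wgt β s φ ξ ^ (γ - β) * ‖h s‖ := by
  refine ⟨(1 + |γ - β|) ^ |γ - β|, fun d _ φ ξ hne h hh hint => ?_⟩
  set a := γ - β
  set C : ℝ := (1 + |a|) ^ |a|
  have hK0 : ∀ t s, 0 < Kker β t s φ ξ := fun t s => Real.exp_pos _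
  have hWa : ∀ t, 0 < Wgt β t φ ξ ^ a := fun t => rpow_pos_of_pos (Wgt_pos β hne t) _
  have hWc : Continuous fun t => Wgt β t φ ξ ^ a :=
    (continuous_Wgt φ ξ).rpow_const fun t => Or.inl (Wgt_pos β hne t).ne'
  let G : ℝ → ℝ → ℂ := fun t =>
    (Set.Iic t).indicator fun s => (↑(Wgt β t φ ξ ^ a * Kker β t s φ ξ) : ℂ) * h s
  have hGmeas : ∀ t, AEStronglyMeasurable (G t) volume := fun t =>
    ((Measurable.mul (Complex.measurable_ofReal.comp
      ((continuous_Kker_right hβ t φ ξ).measurable.const_mul _)) hh).indicator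
        measurableSet_Iic).aestronglyMeasurable
  have hGbound : ∀ t s, ‖G t s‖ ≤ C * (Wgt β s φ ξ ^ a * ‖h s‖) := by
    intro t s
    by_cases hst : s ≤ t
    · have hpos := mul_pos (hWa t) (hK0 t s)
      simp only [G, Set.indicator_of_mem (Set.mem_Iic.2 hst), norm_mul, Complex.norm_real,
        Real.norm_eq_abs, ← abs_mul, abs_of_pos hpos]
      rw [← mul_assoc]
      exact mul_le_mul_of_nonneg_right (Wgt_rpow_mul_Kker_le hβ a hne hst) (norm_nonneg _)
    · have := (hWa s).le
      simp only [G, Set.indicator_of_notMem (mt Set.mem_Iic.1 hst), norm_zero]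
      positivity
  have hGdom : Integrable fun s => C * (Wgt β s φ ξ ^ a * ‖h s‖) := hint.const_mul C
  have hGint : ∀ t, Integrable (G t) := fun t =>
    hGdom.mono' (hGmeas t) (Eventually.of_forall (hGbound t))
  have hG : ∀ t, (↑(Wgt β t φ ξ ^ a) : ℂ) * Duh β φ ξ h t = ∫ s, G t s := by
    intro t
    simp only [G, Duh]
    rw [integral_indicator measurableSet_Iic, ← integral_const_mul]
    simp only [Complex.ofReal_mul, mul_assoc]
  simp only [hG]
  refine ⟨fun t => ?_, ?_, ?_, ?_, fun t => ?_⟩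
  · have hWne : (↑(Wgt β t φ ξ ^ a) : ℂ) ≠ 0 := Complex.ofReal_ne_zero.2 (hWa t).ne'
    have h1 := ((integrable_indicator_iff measurableSet_Iic).1 (hGint t)).const_mul
      (↑(Wgt β t φ ξ ^ a) : ℂ)⁻¹
    refine h1.congr (Eventually.of_forall fun s => ?_)
    simp only [Complex.ofReal_mul]
    field_simp
  · refine continuous_iff_continuousAt.2 fun t₀ => ?_
    refine tendsto_integral_filter_of_dominated_convergence _ (Eventually.of_forall hGmeas)
      (Eventually.of_forall fun t => Eventually.of_forall (hGbound t)) hGdom ?_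
    filter_upwards [Measure.ae_ne volume t₀] with s hs
    rcases lt_or_gt_of_ne hs with hlt | hgt
    · have hc : Continuous fun t => (↑(Wgt β t φ ξ ^ a * Kker β t s φ ξ) : ℂ) * h s :=
        (Complex.continuous_ofReal.comp (hWc.mul (continuous_Kker_left hβ s φ ξ))).mul
          continuous_const
      have heq : ∀ t, s ≤ t → G t s = (↑(Wgt β t φ ξ ^ a * Kker β t s φ ξ) : ℂ) * h s :=
        fun t ht => Set.indicator_of_mem (Set.mem_Iic.2 ht) _
      rw [heq t₀ hlt.le]
      refine (hc.tendsto t₀).congr' ?_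
      filter_upwards [eventually_gt_nhds hlt] with t ht using (heq t ht.le).symm
    · have heq : ∀ t, t < s → G t s = 0 := fun t ht =>
        Set.indicator_of_notMem (mt Set.mem_Iic.1 ht.not_ge) _
      rw [heq t₀ hgt]
      refine tendsto_const_nhds.congr' ?_
      filter_upwards [eventually_lt_nhds hgt] with t ht using (heq t ht).symm
  · rw [← integral_zero ℝ ℂ]
    refine tendsto_integral_filter_of_dominated_convergence _ (Eventually.of_forall hGmeas)
      (Eventually.of_forall fun t => Eventually.of_forall (hGbound t)) hGdom
      (Eventually.of_forall fun s => ?_)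
    have hlim := ((Complex.continuous_ofReal.tendsto 0).comp
      (tendsto_Wgt_rpow_mul_Kker hβ a hne s)).mul_const (h s)
    rw [Complex.ofReal_zero, zero_mul] at hlim
    refine hlim.congr' ?_
    filter_upwards [eventually_ge_atTop s] with t ht
    simp only [G, Set.indicator_of_mem (Set.mem_Iic.2 ht), Function.comp_apply]
  · rw [← integral_zero ℝ ℂ]
    refine tendsto_integral_filter_of_dominated_convergence _ (Eventually.of_forall hGmeas)
      (Eventually.of_forall fun t => Eventually.of_forall (hGbound t)) hGdom
      (Eventually.of_forall fun s => ?_)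
    refine tendsto_const_nhds.congr' ?_
    filter_upwards [eventually_lt_atBot s] with t ht
    exact (Set.indicator_of_notMem (mt Set.mem_Iic.1 ht.not_ge) _).symm
  · calc Wgt β t φ ξ ^ a * ‖Duh β φ ξ h t‖
        = ‖(↑(Wgt β t φ ξ ^ a) : ℂ) * Duh β φ ξ h t‖ := by
          rw [norm_mul, Complex.norm_real, Real.norm_eq_abs, abs_of_pos (hWa t)]
      _ = ‖∫ s, G t s‖ := by rw [hG]
      _ ≤ ∫ s, C * (Wgt β s φ ξ ^ a * ‖h s‖) :=
          norm_integral_le_of_norm_le hGdom (Eventually.of_forall (hGbound t))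
      _ = C * ∫ s, Wgt β s φ ξ ^ a * ‖h s‖ := integral_const_mul _ _
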